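/- arXiv:2407.07699 — 2 statements merged into one kernel-verified Lean document; each statement's English description precedes it below -/
import Mathlib

section
/- Fix N ≥ 1, deterministic matrices A, B ∈ ℂ^{N×N}, a point θ ∈ ℝ^N, and an index n. For t ∈ ℝ let θ[n:=t] be θ with its n-th coordinate replaced by t. Then the function t ↦ Tr(A · Φ(θ[n:=t]) · B · Φ(θ[n:=t])ᴴ) is differentiable at t = θ_n with derivative equal to i·[Φ(θ)ᵀ (Aᵀ ⊙ B) conj(c(θ))]_n − i·[Φ(θ)ᴴ (A ⊙ Bᵀ) c(θ)]_n. -/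
open Matrix
open scoped ComplexConjugate

noncomputable section

/-- The phase vector `c(θ) ∈ ℂ^N` with entries `c(θ)_n = exp(i·θ_n)`. -/
def phaseVec {N : ℕ} (θ : Fin N → ℝ) : Fin N → ℂ :=
  fun n => Complex.exp ((θ n : ℂ) * Complex.I)

/-- The diagonal phase-shift matrix `Φ(θ) = diag(c(θ))`. -/
def phaseMat {N : ℕ} (θ : Fin N → ℝ) : Matrix (Fin N) (Fin N) ℂ :=
  Matrix.diagonal (phaseVec θ)

theorem trace_mul_diagonal_mul_mul_conjTranspose_diagonal {ι R : Type*} [Fintype ι] [DecidableEq ι]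
    [CommSemiring R] [StarRing R] (A B : Matrix ι ι R) (c : ι → R) :
    (A * diagonal c * B * (diagonal c)ᴴ).trace =
      ∑ j, ∑ k, A j k * c k * B k j * star (c j) := by
  simp [trace, diagonal_conjTranspose, mul_diagonal, mul_apply (N := B), Finset.sum_mul]

theorem hasDerivAt_phaseVec_update {N : ℕ} (θ : Fin N → ℝ) (n k : Fin N) :
    HasDerivAt (fun t : ℝ => phaseVec (Function.update θ n t) k)
      (if k = n then Complex.I * phaseVec θ n else 0) (θ n) := by
  by_cases h : k = n
  · subst h
    simpa [phaseVec, mul_comm] using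
      ((hasDerivAt_id (θ k)).ofReal_comp.mul_const Complex.I).cexp
  · simpa [phaseVec, h] using hasDerivAt_const (θ n) (phaseVec θ k)

/-- **Derivative of `Tr(A Φ B Φᴴ)` in a single phase.** The map
`t ↦ Tr(A·Φ(θ[n:=t])·B·Φ(θ[n:=t])ᴴ)` is differentiable at `t = θ_n` with derivative
`i·[Φᵀ(Aᵀ ⊙ B) conj(c)]_n − i·[Φᴴ(A ⊙ Bᵀ) c]_n`, evaluated at `θ`. -/
theorem hasDerivAt_trace_APhiBPhiH
    (N : ℕ) (hN : 0 < N) (A B : Matrix (Fin N) (Fin N) ℂ)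
    (θ : Fin N → ℝ) (n : Fin N) :
    HasDerivAt
      (fun t : ℝ =>
        (A * phaseMat (Function.update θ n t) * B * (phaseMat (Function.update θ n t))ᴴ).trace)
      (Complex.I * (((phaseMat θ)ᵀ * Matrix.hadamard Aᵀ B) *ᵥ star (phaseVec θ)) n
        - Complex.I * (((phaseMat θ)ᴴ * Matrix.hadamard A Bᵀ) *ᵥ phaseVec θ) n)
      (θ n) := by
  have hd : HasDerivAt
      (fun t : ℝ => ∑ j, ∑ k, A j k * phaseVec (Function.update θ n t) k * B k j *
        star (phaseVec (Function.update θ n t) j)) _ (θ n) :=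
    HasDerivAt.fun_sum fun j _ => HasDerivAt.fun_sum fun k _ =>
      (((hasDerivAt_phaseVec_update θ n k).const_mul (A j k)).mul_const (B k j)).mul
        (hasDerivAt_phaseVec_update θ n j).star
  simp only [phaseMat, trace_mul_diagonal_mul_mul_conjTranspose_diagonal]
  convert hd using 1
  simp only [Function.update_eq_self, Finset.sum_add_distrib, sub_eq_add_neg]
  congr 1
  · simp only [mul_ite, ite_mul, mul_zero, zero_mul, Finset.sum_ite_eq', Finset.mem_univ, if_true,
      mulVec, dotProduct, diagonal_transpose, diagonal_mul, hadamard_apply, transpose_apply,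
      Pi.star_apply, Finset.mul_sum]
    exact Finset.sum_congr rfl fun j _ => by ring
  · rw [Finset.sum_comm]
    simp only [apply_ite star, star_zero, mul_ite, mul_zero, Finset.sum_ite_eq', Finset.mem_univ,
      if_true, mulVec, dotProduct, diagonal_conjTranspose, diagonal_mul, hadamard_apply,
      transpose_apply, Pi.star_apply, Finset.mul_sum, star_mul', Complex.star_def, Complex.conj_I,
      ← Finset.sum_neg_distrib]
    exact Finset.sum_congr rfl fun k _ => by ring
end
end

section
/- Fix N, M ≥ 1, deterministic matrices H̄₂ ∈ ℂ^{M×N} and R_k, R_i ∈ ℂ^{N×N}, a point θ⁰ ∈ ℝ^N, and an index n. Write Φ⁰ = Φ(θ⁰), c⁰ = c(θ⁰), and for matrices X, Y ∈ ℂ^{N×N} define g(X,Y)_n = i·[(Φ⁰)ᵀ (Xᵀ ⊙ Y) conj(c⁰)]_n − i·[(Φ⁰)ᴴ (X ⊙ Yᵀ) c⁰]_n. Then the partial derivative with respect to θ_n at θ⁰ of the function θ ↦ Tr( H̄₂ Φ(θ) R_k Φ(θ)ᴴ H̄₂ᴴ H̄₂ Φ(θ) R_i Φ(θ)ᴴ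 H̄₂ᴴ ) equals g( H̄₂ᴴ H̄₂ Φ⁰ R_i (Φ⁰)ᴴ H̄₂ᴴ H̄₂, R_k )_n + g( H̄₂ᴴ H̄₂ Φ⁰ R_k (Φ⁰)ᴴ H̄₂ᴴ H̄₂, R_i )_n. -/
open Matrix
open scoped ComplexConjugate

noncomputable section

/-- Product rule for matrix-valued curves, entry by entry. -/
lemma hasDerivAt_matrix_mul_apply {l m p : Type*} [Fintype m]
    {F : ℝ → Matrix l m ℂ} {G : ℝ → Matrix m p ℂ} {F' : Matrix l m ℂ} {G' : Matrix m p ℂ} {x : ℝ}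
    (hF : ∀ i j, HasDerivAt (fun t => F t i j) (F' i j) x)
    (hG : ∀ i j, HasDerivAt (fun t => G t i j) (G' i j) x) (i : l) (j : p) :
    HasDerivAt (fun t => (F t * G t) i j) ((F' * G x + F x * G') i j) x := by
  simp only [Matrix.add_apply, Matrix.mul_apply, ← Finset.sum_add_distrib]
  exact HasDerivAt.fun_sum fun k _ => (hF i k).mul (hG k j)

lemma hasDerivAt_matrix_mul_const_apply {l m p : Type*} [Fintype m]
    {F : ℝ → Matrix l m ℂ} {F' : Matrix l m ℂ} {x : ℝ}
    (hF : ∀ i j, HasDerivAt (fun t => F t i j) (F' i j) x) (B : Matrix m p ℂ) (i : l) (j : p) :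
    HasDerivAt (fun t => (F t * B) i j) ((F' * B) i j) x := by
  simpa using hasDerivAt_matrix_mul_apply (G := fun _ => B) (G' := 0) hF
    (fun i j => hasDerivAt_const x (B i j)) i j

lemma hasDerivAt_phaseMat_update_apply {N : ℕ} (θ : Fin N → ℝ) (n i j : Fin N) :
    HasDerivAt (fun t : ℝ => phaseMat (Function.update θ n t) i j)
      (Matrix.single n n (Complex.I * phaseVec θ n) i j) (θ n) := by
  by_cases hij : i = j
  · subst hij
    by_cases hin : i = n
    · subst hin
      have h := ((Complex.ofRealCLM.hasDerivAt (x := θ i)).mul_const Complex.I).cexp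
      simpa [phaseMat, phaseVec, mul_comm] using h
    · simpa [phaseMat, phaseVec, Function.update_of_ne hin, Matrix.single_apply, Ne.symm hin]
        using hasDerivAt_const (θ n) (Complex.exp ((θ i : ℂ) * Complex.I))
  · have h : ¬(n = i ∧ n = j) := fun h => hij (h.1.symm.trans h.2)
    simpa [phaseMat, Matrix.diagonal_apply_ne _ hij, Matrix.single_apply, h]
      using hasDerivAt_const (θ n) (0 : ℂ)

lemma hasDerivAt_conjTranspose_phaseMat_update_apply {N : ℕ} (θ : Fin N → ℝ) (n i j : Fin N) :
    HasDerivAt (fun t : ℝ => (phaseMat (Function.update θ n t))ᴴ i j)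
      ((Matrix.single n n (Complex.I * phaseVec θ n))ᴴ i j) (θ n) :=
  (hasDerivAt_phaseMat_update_apply θ n j i).star

/-- The gradient expression `g(X,Y)_n` as a pair of traces against the derivative of the
phase-shift matrix. -/
lemma phase_gradient_eq_trace {N : ℕ} (θ : Fin N → ℝ) (n : Fin N) (X Y : Matrix (Fin N) (Fin N) ℂ) :
    Complex.I * (((phaseMat θ)ᵀ * Matrix.hadamard Xᵀ Y) *ᵥ star (phaseVec θ)) n
        - Complex.I * (((phaseMat θ)ᴴ * Matrix.hadamard X Yᵀ) *ᵥ phaseVec θ) n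
      = (Matrix.single n n (Complex.I * phaseVec θ n) * (Y * (phaseMat θ)ᴴ * X)).trace
        + ((Matrix.single n n (Complex.I * phaseVec θ n))ᴴ * (X * phaseMat θ * Y)).trace := by
  rw [Matrix.conjTranspose_single, Matrix.trace_single_mul, Matrix.trace_single_mul]
  simp only [phaseMat, Matrix.diagonal_transpose, Matrix.diagonal_conjTranspose,
    Matrix.mulVec, dotProduct, Matrix.diagonal_mul, Matrix.hadamard_apply, Matrix.transpose_apply,
    Matrix.mul_apply (M := _ * _), Matrix.mul_diagonal, Pi.star_apply, smul_eq_mul,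
    Finset.mul_sum, sub_eq_add_neg, ← Finset.sum_neg_distrib]
  congr 1 <;> refine Finset.sum_congr rfl fun m _ => ?_
  · ring
  · simp
    ring

/-- **Gradient of `f_{ki,1,2}` via the chain rule.** With
`g(X,Y)_n = i·[Φ⁰ᵀ(Xᵀ ⊙ Y) conj(c⁰)]_n − i·[Φ⁰ᴴ(X ⊙ Yᵀ) c⁰]_n`, the partial derivative
of `θ ↦ Tr(H̄₂ Φ R_k Φᴴ H̄₂ᴴ H̄₂ Φ R_i Φᴴ H̄₂ᴴ)` in the coordinate `θ_n` at `θ⁰` equals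
`g(H̄₂ᴴH̄₂Φ⁰R_iΦ⁰ᴴH̄₂ᴴH̄₂, R_k)_n + g(H̄₂ᴴH̄₂Φ⁰R_kΦ⁰ᴴH̄₂ᴴH̄₂, R_i)_n`. -/
theorem hasDerivAt_trace_f_ki_12
    (N M : ℕ) (hN : 0 < N) (hM : 0 < M)
    (H2 : Matrix (Fin M) (Fin N) ℂ) (Rk Ri : Matrix (Fin N) (Fin N) ℂ)
    (θ0 : Fin N → ℝ) (n : Fin N) :
    let Φ0 : Matrix (Fin N) (Fin N) ℂ := phaseMat θ0
    let c0 : Fin N → ℂ := phaseVec θ0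
    let g : Matrix (Fin N) (Fin N) ℂ → Matrix (Fin N) (Fin N) ℂ → ℂ := fun X Y =>
      Complex.I * ((Φ0ᵀ * Matrix.hadamard Xᵀ Y) *ᵥ star c0) n
        - Complex.I * ((Φ0ᴴ * Matrix.hadamard X Yᵀ) *ᵥ c0) n
    HasDerivAt
      (fun t : ℝ =>
        (H2 * phaseMat (Function.update θ0 n t) * Rk
            * (phaseMat (Function.update θ0 n t))ᴴ * H2ᴴ
            * H2 * phaseMat (Function.update θ0 n t) * Ri
            * (phaseMat (Function.update θ0 n t))ᴴ * H2ᴴ).trace)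
      (g (H2ᴴ * H2 * Φ0 * Ri * Φ0ᴴ * H2ᴴ * H2) Rk
        + g (H2ᴴ * H2 * Φ0 * Rk * Φ0ᴴ * H2ᴴ * H2) Ri)
      (θ0 n) := by
  intro Φ0 c0 g
  have hΦ := hasDerivAt_phaseMat_update_apply θ0 n
  have hΦH := hasDerivAt_conjTranspose_phaseMat_update_apply θ0 n
  have hH2 : ∀ i j, HasDerivAt (fun t : ℝ => (H2 * phaseMat (Function.update θ0 n t)) i j)
      ((H2 * Matrix.single n n (Complex.I * phaseVec θ0 n)) i j) (θ0 n) := fun i j => by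
    simpa using hasDerivAt_matrix_mul_apply (F := fun _ => H2) (F' := 0)
      (fun i j => hasDerivAt_const (θ0 n) (H2 i j)) hΦ i j
  have h₁ := hasDerivAt_matrix_mul_apply (hasDerivAt_matrix_mul_const_apply hH2 Rk) hΦH
  have h₂ := hasDerivAt_matrix_mul_const_apply (hasDerivAt_matrix_mul_const_apply h₁ H2ᴴ) H2
  have h₃ := hasDerivAt_matrix_mul_const_apply (hasDerivAt_matrix_mul_apply h₂ hΦ) Ri
  have h₄ := hasDerivAt_matrix_mul_const_apply (hasDerivAt_matrix_mul_apply h₃ hΦH) H2ᴴ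
  have h := HasDerivAt.fun_sum (u := Finset.univ) fun i _ => h₄ i i
  refine h.congr_deriv ?_
  change Matrix.trace _ = _
  simp only [g, c0, Φ0, phase_gradient_eq_trace, Function.update_eq_self]
  generalize Matrix.single n n (Complex.I * phaseVec θ0 n) = D
  generalize phaseMat θ0 = Φ
  have e₁ : (H2 * D * Rk * Φᴴ * H2ᴴ * H2 * Φ * Ri * Φᴴ * H2ᴴ).trace
      = (D * (Rk * Φᴴ * (H2ᴴ * H2 * Φ * Ri * Φᴴ * H2ᴴ * H2))).trace := by
    simpa only [Matrix.mul_assoc] using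
      Matrix.trace_mul_comm H2 (D * Rk * Φᴴ * H2ᴴ * H2 * Φ * Ri * Φᴴ * H2ᴴ)
  have e₂ : (H2 * Φ * Rk * Dᴴ * H2ᴴ * H2 * Φ * Ri * Φᴴ * H2ᴴ).trace
      = (Dᴴ * ((H2ᴴ * H2 * Φ * Ri * Φᴴ * H2ᴴ * H2) * Φ * Rk)).trace := by
    simpa only [Matrix.mul_assoc] using
      Matrix.trace_mul_comm (H2 * Φ * Rk) (Dᴴ * H2ᴴ * H2 * Φ * Ri * Φᴴ * H2ᴴ)
  have e₃ : (H2 * Φ * Rk * Φᴴ * H2ᴴ * H2 * D * Ri * Φᴴ * H2ᴴ).trace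
      = (D * (Ri * Φᴴ * (H2ᴴ * H2 * Φ * Rk * Φᴴ * H2ᴴ * H2))).trace := by
    simpa only [Matrix.mul_assoc] using
      Matrix.trace_mul_comm (H2 * Φ * Rk * Φᴴ * H2ᴴ * H2) (D * Ri * Φᴴ * H2ᴴ)
  have e₄ : (H2 * Φ * Rk * Φᴴ * H2ᴴ * H2 * Φ * Ri * Dᴴ * H2ᴴ).trace
      = (Dᴴ * ((H2ᴴ * H2 * Φ * Rk * Φᴴ * H2ᴴ * H2) * Φ * Ri)).trace := by
    simpa only [Matrix.mul_assoc] using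
      Matrix.trace_mul_comm (H2 * Φ * Rk * Φᴴ * H2ᴴ * H2 * Φ * Ri) (Dᴴ * H2ᴴ)
  simp only [Matrix.add_mul, Matrix.trace_add, e₁, e₂, e₃, e₄]
  ring
end
end
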